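/- Let S be a set of n ≥ 3 pairwise distinct trajectories and let 1 ≤ k ≤ n. Let 𝒞* be an SD-optimal k-clustering of S, and let 𝒞' be a well-separated k-clustering of S with sd(𝒞') minimal among all well-separated k-clusterings of S. Then sd(𝒞') ≤ (1 + ⌊k/2⌋)·sd(𝒞*). -/

import Mathlib

noncomputable section

/-- Position at time `t` of the trajectory `(a, v)`, i.e. `a + v*t`. -/
def trajPos (s : ℝ × ℝ) (t : ℝ) : ℝ := s.1 + s.2 * t

/-- Diameter of a finite set of trajectories: the integral over `[0,1]` of the
width of the set of positions; `0` for the empty set. -/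
noncomputable def kdiam (C : Finset (ℝ × ℝ)) : ℝ :=
  if h : C.Nonempty then
    ∫ t in (0:ℝ)..1,
      (C.sup' h (fun s => trajPos s t) - C.inf' h (fun s => trajPos s t))
  else 0

/-- A `k`-clustering of `S`: pairwise disjoint (possibly empty) clusters
indexed by `Fin k` whose union is `S`. -/
def IsClustering (S : Finset (ℝ × ℝ)) (k : ℕ) (𝒞 : Fin k → Finset (ℝ × ℝ)) : Prop :=
  (∀ i j : Fin k, i ≠ j → Disjoint (𝒞 i) (𝒞 j)) ∧
  Finset.univ.biUnion 𝒞 = S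

/-- Sum of the diameters of the clusters. -/
noncomputable def sd {k : ℕ} (𝒞 : Fin k → Finset (ℝ × ℝ)) : ℝ :=
  ∑ i, kdiam (𝒞 i)

/-- Maximum diameter of a cluster. -/
noncomputable def md {k : ℕ} (𝒞 : Fin k → Finset (ℝ × ℝ)) : ℝ :=
  ⨆ i, kdiam (𝒞 i)

/-- An SD-optimal `k`-clustering: minimizes `sd` among all `k`-clusterings of `S`. -/
def SDOptimal (S : Finset (ℝ × ℝ)) (k : ℕ) (𝒞 : Fin k → Finset (ℝ × ℝ)) : Prop :=
  IsClustering S k 𝒞 ∧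
  ∀ 𝒟 : Fin k → Finset (ℝ × ℝ), IsClustering S k 𝒟 → sd 𝒞 ≤ sd 𝒟

/-- Optimal value of the maximum diameter over all `k`-clusterings of `S`. -/
noncomputable def optmd (S : Finset (ℝ × ℝ)) (k : ℕ) : ℝ :=
  sInf {x | ∃ 𝒞 : Fin k → Finset (ℝ × ℝ), IsClustering S k 𝒞 ∧ x = md 𝒞}

/-- The strip `{(x,t) : 0 ≤ t ≤ 1}`. -/
def strip : Set (ℝ × ℝ) := {p | 0 ≤ p.2 ∧ p.2 ≤ 1}

/-- The graph of a trajectory inside the strip. -/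
def trajGraph (s : ℝ × ℝ) : Set (ℝ × ℝ) :=
  {p | 0 ≤ p.2 ∧ p.2 ≤ 1 ∧ p.1 = trajPos s p.2}

/-- The strip minus the union of the graphs of the trajectories of `S`. -/
def freeRegion (S : Finset (ℝ × ℝ)) : Set (ℝ × ℝ) :=
  strip \ ⋃ s ∈ S, trajGraph s

/-- A hole of `S`: a connected component of the strip minus the graphs. -/
def IsHole (S : Finset (ℝ × ℝ)) (h : Set (ℝ × ℝ)) : Prop :=
  ∃ p ∈ freeRegion S, h = connectedComponentIn (freeRegion S) p

/-- `s` is to the left of the hole `h`. -/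
def LeftOf (s : ℝ × ℝ) (h : Set (ℝ × ℝ)) : Prop :=
  ∃ p ∈ h, trajPos s p.2 < p.1

open Classical in
/-- The trajectories of `S` to the left of `h`. -/
noncomputable def Sleft (S : Finset (ℝ × ℝ)) (h : Set (ℝ × ℝ)) : Finset (ℝ × ℝ) :=
  S.filter (fun s => LeftOf s h)

open Classical in
/-- The trajectories of `S` to the right of `h`. -/
noncomputable def Sright (S : Finset (ℝ × ℝ)) (h : Set (ℝ × ℝ)) : Finset (ℝ × ℝ) :=
  S.filter (fun s => ¬ LeftOf s h)

/-- The hole `h` separates the clusters `A` and `B`. -/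
def Separates (S : Finset (ℝ × ℝ)) (h : Set (ℝ × ℝ))
    (A B : Finset (ℝ × ℝ)) : Prop :=
  (A ⊆ Sleft S h ∧ B ⊆ Sright S h) ∨ (B ⊆ Sleft S h ∧ A ⊆ Sright S h)

/-- The span of a cluster: the region of the strip between its left and right sides. -/
noncomputable def cspan (C : Finset (ℝ × ℝ)) : Set (ℝ × ℝ) :=
  if h : C.Nonempty then
    {p | 0 ≤ p.2 ∧ p.2 ≤ 1 ∧
      C.inf' h (fun s => trajPos s p.2) ≤ p.1 ∧
      p.1 ≤ C.sup' h (fun s => trajPos s p.2)}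
  else ∅

/-- A hole is covered by a clustering if it is contained in the span of some cluster. -/
def Covered {k : ℕ} (𝒞 : Fin k → Finset (ℝ × ℝ)) (h : Set (ℝ × ℝ)) : Prop :=
  ∃ i, h ⊆ cspan (𝒞 i)

/-- A well-separated clustering: every two distinct nonempty clusters are
separated by some uncovered hole. -/
def WellSeparated (S : Finset (ℝ × ℝ)) (k : ℕ)
    (𝒞 : Fin k → Finset (ℝ × ℝ)) : Prop :=
  IsClustering S k 𝒞 ∧
  ∀ i j : Fin k, i ≠ j → (𝒞 i).Nonempty → (𝒞 j).Nonempty →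
    ∃ h, IsHole S h ∧ ¬ Covered 𝒞 h ∧ Separates S h (𝒞 i) (𝒞 j)

end

noncomputable section

variable {S : Finset (ℝ × ℝ)} {h : Set (ℝ × ℝ)} {k : ℕ}

/-- The width of a finite set of trajectories at time `t`. -/
def spread (C : Finset (ℝ × ℝ)) (t : ℝ) : ℝ :=
  if h : C.Nonempty then
    C.sup' h (fun s => trajPos s t) - C.inf' h (fun s => trajPos s t)
  else 0

theorem continuous_trajPos (s : ℝ × ℝ) : Continuous (trajPos s) := by
  unfold trajPos; fun_prop

theorem continuous_spread (C : Finset (ℝ × ℝ)) : Continuous (spread C) := by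
  unfold spread
  split_ifs with h
  · exact (Continuous.finset_sup'_apply h fun s _ => continuous_trajPos s).sub
      (Continuous.finset_inf'_apply h fun s _ => continuous_trajPos s)
  · exact continuous_const

theorem spread_nonneg (C : Finset (ℝ × ℝ)) (t : ℝ) : 0 ≤ spread C t := by
  unfold spread
  split_ifs with h
  · obtain ⟨s, hs⟩ := h
    exact sub_nonneg.2 ((Finset.inf'_le (fun s => trajPos s t) hs).trans
      (Finset.le_sup' (fun s => trajPos s t) hs))
  · exact le_rfl

theorem kdiam_eq_integral_spread (C : Finset (ℝ × ℝ)) :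
    kdiam C = ∫ t in (0 : ℝ)..1, spread C t := by
  unfold kdiam spread
  split_ifs <;> simp

theorem kdiam_nonneg (C : Finset (ℝ × ℝ)) : 0 ≤ kdiam C := by
  rw [kdiam_eq_integral_spread]
  exact intervalIntegral.integral_nonneg zero_le_one fun t _ => spread_nonneg C t

theorem sd_nonneg (𝒞 : Fin k → Finset (ℝ × ℝ)) : 0 ≤ sd 𝒞 :=
  Finset.sum_nonneg fun i _ => kdiam_nonneg (𝒞 i)

theorem mem_cspan_iff {C : Finset (ℝ × ℝ)} {p : ℝ × ℝ} :
    p ∈ cspan C ↔ (0 ≤ p.2 ∧ p.2 ≤ 1) ∧ (∃ s ∈ C, trajPos s p.2 ≤ p.1) ∧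
      ∃ s ∈ C, p.1 ≤ trajPos s p.2 := by
  unfold cspan
  split_ifs with hC
  · simp [Finset.inf'_le_iff, Finset.le_sup'_iff, and_assoc]
  · simp [Finset.not_nonempty_iff_eq_empty.1 hC]

theorem mem_Sleft {s : ℝ × ℝ} : s ∈ Sleft S h ↔ s ∈ S ∧ LeftOf s h := by
  simp [Sleft]

theorem mem_Sright {s : ℝ × ℝ} : s ∈ Sright S h ↔ s ∈ S ∧ ¬ LeftOf s h := by
  simp [Sright]

theorem IsHole.subset_freeRegion (hh : IsHole S h) : h ⊆ freeRegion S := by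
  obtain ⟨p, -, rfl⟩ := hh
  exact connectedComponentIn_subset _ _

theorem IsHole.trajPos_ne (hh : IsHole S h) {s p : ℝ × ℝ} (hs : s ∈ S) (hp : p ∈ h) :
    trajPos s p.2 ≠ p.1 := by
  intro he
  obtain ⟨⟨h0, h1⟩, hn⟩ := hh.subset_freeRegion hp
  exact hn (Set.mem_biUnion hs ⟨h0, h1, he.symm⟩)

/-- A trajectory of `S` lies on the same side of all the points of a hole. -/
theorem IsHole.trajPos_lt_of_leftOf (hh : IsHole S h) {s : ℝ × ℝ} (hs : s ∈ S)
    (hl : LeftOf s h) {p : ℝ × ℝ} (hp : p ∈ h) : trajPos s p.2 < p.1 := by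
  obtain ⟨q, hq, hlt⟩ := hl
  by_contra! hle
  have hpre : IsPreconnected h := by
    obtain ⟨p, -, rfl⟩ := hh
    exact isPreconnected_connectedComponentIn
  obtain ⟨r, hr, he⟩ := hpre.intermediate_value₂ hq hp
    ((continuous_trajPos s).comp continuous_snd).continuousOn
    continuous_fst.continuousOn hlt.le hle
  exact hh.trajPos_ne hs hr he

/-- A cluster which does not lie on one side of a hole covers it. -/
theorem IsHole.subset_cspan (hh : IsHole S h) {C : Finset (ℝ × ℝ)} (hC : C ⊆ S)
    (hl : ¬ C ⊆ Sleft S h) (hr : ¬ C ⊆ Sright S h) : h ⊆ cspan C := by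
  obtain ⟨s, hs, hsl⟩ := Finset.not_subset.1 hl
  obtain ⟨s', hs', hsr⟩ := Finset.not_subset.1 hr
  have h1 : ¬ LeftOf s h := fun H => hsl (mem_Sleft.2 ⟨hC hs, H⟩)
  have h2 : LeftOf s' h := by
    by_contra H
    exact hsr (mem_Sright.2 ⟨hC hs', H⟩)
  intro p hp
  refine mem_cspan_iff.2 ⟨(hh.subset_freeRegion hp).1,
    ⟨s', hs', (hh.trajPos_lt_of_leftOf (hC hs') h2 hp).le⟩, s, hs, ?_⟩
  by_contra! hlt
  exact h1 ⟨p, hp, hlt⟩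

/-- A cluster covering a point of a hole has trajectories on both sides of it. -/
theorem IsHole.not_subset_of_mem_cspan (hh : IsHole S h) {C : Finset (ℝ × ℝ)} (hC : C ⊆ S)
    {p : ℝ × ℝ} (hp : p ∈ h) (hpC : p ∈ cspan C) :
    ¬ C ⊆ Sleft S h ∧ ¬ C ⊆ Sright S h := by
  obtain ⟨-, ⟨s, hs, hle⟩, s', hs', hge⟩ := mem_cspan_iff.1 hpC
  refine ⟨fun H => ?_, fun H => ?_⟩
  · exact (hh.trajPos_lt_of_leftOf (hC hs') (mem_Sleft.1 (H hs')).2 hp).not_ge hge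
  · exact (mem_Sright.1 (H hs)).2 ⟨p, hp, hle.lt_of_ne (hh.trajPos_ne (hC hs) hp)⟩

theorem IsHole.nonempty (hh : IsHole S h) : h.Nonempty := by
  obtain ⟨p, hp, rfl⟩ := hh
  exact ⟨p, mem_connectedComponentIn hp⟩

/-- The spread of a set all of whose covered holes are covered by `𝒞` is at most the total
spread of `𝒞`. -/
theorem spread_le_sum_spread {𝒞 : Fin k → Finset (ℝ × ℝ)} (h𝒞 : IsClustering S k 𝒞)
    {M : Finset (ℝ × ℝ)} (hM : ∀ h, IsHole S h → h ∩ cspan M ≠ ∅ → Covered 𝒞 h)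
    {t : ℝ} (h0 : 0 ≤ t) (h1 : t ≤ 1) : spread M t ≤ ∑ i, spread (𝒞 i) t := by
  have mem_slice : ∀ (C : Finset (ℝ × ℝ)) (x : ℝ), (x, t) ∈ cspan C →
      ∃ hC : C.Nonempty, x ∈ Set.Icc (C.inf' hC fun s => trajPos s t)
        (C.sup' hC fun s => trajPos s t) := by
    intro C x hx
    unfold cspan at hx
    split_ifs at hx with hC
    · exact ⟨hC, hx.2.2⟩
    · exact hx.elim
  have volume_slice : ∀ C : Finset (ℝ × ℝ),
      MeasureTheory.volume {x | (x, t) ∈ cspan C} = ENNReal.ofReal (spread C t) := by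
    intro C
    unfold cspan spread
    split_ifs with hC
    · simp only [Set.mem_ofPred_eq, h0, h1, true_and]
      exact Real.volume_Icc
    · simp
  have slice_subset : {x | (x, t) ∈ cspan M} ⊆ ⋃ i, {x | (x, t) ∈ cspan (𝒞 i)} := by
    intro x hx
    rw [Set.mem_iUnion]
    by_cases hfree : (x, t) ∈ freeRegion S
    · have hmem := mem_connectedComponentIn hfree
      obtain ⟨i, hi⟩ := hM _ ⟨_, hfree, rfl⟩ (Set.nonempty_iff_ne_empty.1 ⟨_, hmem, hx⟩)
      exact ⟨i, hi hmem⟩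
    · have : (x, t) ∈ ⋃ s ∈ S, trajGraph s := by
        by_contra H
        exact hfree ⟨⟨h0, h1⟩, H⟩
      obtain ⟨s, hs, -, -, he⟩ := Set.mem_iUnion₂.1 this
      rw [← h𝒞.2, Finset.mem_biUnion] at hs
      obtain ⟨i, -, hi⟩ := hs
      exact ⟨i, mem_cspan_iff.2 ⟨⟨h0, h1⟩, ⟨s, hi, he.ge⟩, s, hi, he.le⟩⟩
  have hvol := (MeasureTheory.measure_mono slice_subset).trans
    (MeasureTheory.measure_iUnion_fintype_le MeasureTheory.volume _)
  simp only [volume_slice] at hvol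
  rwa [← ENNReal.ofReal_sum_of_nonneg fun i _ => spread_nonneg _ _,
    ENNReal.ofReal_le_ofReal_iff (Finset.sum_nonneg fun i _ => spread_nonneg _ _)] at hvol

theorem kdiam_le_sd {𝒞 : Fin k → Finset (ℝ × ℝ)} (h𝒞 : IsClustering S k 𝒞)
    {M : Finset (ℝ × ℝ)} (hM : ∀ h, IsHole S h → h ∩ cspan M ≠ ∅ → Covered 𝒞 h) :
    kdiam M ≤ sd 𝒞 := by
  simp only [sd, kdiam_eq_integral_spread]
  rw [← intervalIntegral.integral_finsetSum
    fun i _ => (continuous_spread (𝒞 i)).intervalIntegrable 0 1]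
  exact intervalIntegral.integral_mono_on zero_le_one
    ((continuous_spread M).intervalIntegrable 0 1)
    ((continuous_finsetSum _ fun i _ => continuous_spread (𝒞 i)).intervalIntegrable 0 1)
    fun t ht => spread_le_sum_spread h𝒞 hM ht.1 ht.2

theorem IsClustering.subset {𝒞 : Fin k → Finset (ℝ × ℝ)} (h𝒞 : IsClustering S k 𝒞)
    (i : Fin k) : 𝒞 i ⊆ S := by
  rw [← h𝒞.2]
  exact Finset.subset_biUnion_of_mem 𝒞 (Finset.mem_univ i)

/-- The clustering obtained by merging the clusters with the same image under `f`. -/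
def mergeClusters (𝒞 : Fin k → Finset (ℝ × ℝ)) (f : Fin k → Fin k) (j : Fin k) :
    Finset (ℝ × ℝ) :=
  (Finset.univ.filter fun i => f i = j).biUnion 𝒞

theorem mem_mergeClusters {𝒞 : Fin k → Finset (ℝ × ℝ)} {f : Fin k → Fin k} {j : Fin k}
    {s : ℝ × ℝ} : s ∈ mergeClusters 𝒞 f j ↔ ∃ i, f i = j ∧ s ∈ 𝒞 i := by
  simp [mergeClusters]

theorem IsClustering.merge {𝒞 : Fin k → Finset (ℝ × ℝ)} (h𝒞 : IsClustering S k 𝒞)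
    (f : Fin k → Fin k) : IsClustering S k (mergeClusters 𝒞 f) := by
  refine ⟨fun i j hij => Finset.disjoint_left.2 fun s hs hs' => ?_, ?_⟩
  · obtain ⟨a, rfl, ha⟩ := mem_mergeClusters.1 hs
    obtain ⟨b, rfl, hb⟩ := mem_mergeClusters.1 hs'
    exact Finset.disjoint_left.1 (h𝒞.1 a b fun e => hij (congrArg f e)) ha hb
  · rw [← h𝒞.2]
    ext s
    simp [mem_mergeClusters]

/-- The sum of diameters of a merged clustering, when every merged cluster has diameter at most
the original sum of diameters. -/
theorem sd_mergeClusters_le {𝒞 : Fin k → Finset (ℝ × ℝ)} {f : Fin k → Fin k}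
    (hle : ∀ j, kdiam (mergeClusters 𝒞 f j) ≤ sd 𝒞) :
    sd (mergeClusters 𝒞 f) ≤ ((1 + k / 2 : ℕ) : ℝ) * sd 𝒞 := by
  have hsd := sd_nonneg 𝒞
  let fiber : Fin k → Finset (Fin k) := fun j => Finset.univ.filter fun i => f i = j
  have hmaps : ∀ i ∈ (Finset.univ : Finset (Fin k)), f i ∈ (Finset.univ : Finset (Fin k)) :=
    fun i _ => Finset.mem_univ _
  have kdiam_le : ∀ j, kdiam (mergeClusters 𝒞 f j) ≤
      ∑ i ∈ fiber j, kdiam (𝒞 i) + (((fiber j).card / 2 : ℕ) : ℝ) * sd 𝒞 := by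
    intro j
    have hsum : 0 ≤ ∑ i ∈ fiber j, kdiam (𝒞 i) := Finset.sum_nonneg fun i _ => kdiam_nonneg _
    rcases lt_or_ge (fiber j).card 2 with hlt | hge
    · have hM : mergeClusters 𝒞 f j = (fiber j).biUnion 𝒞 := rfl
      rw [hM, Nat.div_eq_of_lt hlt]
      rcases Nat.le_one_iff_eq_zero_or_eq_one.1 (Nat.lt_succ_iff.1 hlt) with h0 | h1
      · simp [Finset.card_eq_zero.1 h0, kdiam]
      · obtain ⟨i, he⟩ := Finset.card_eq_one.1 h1
        simp [he]
    · have h1 : (1 : ℝ) ≤ ((fiber j).card / 2 : ℕ) := by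
        exact_mod_cast (Nat.one_le_div_iff two_pos).2 hge
      nlinarith [hle j]
  have card_le : ∑ j, (fiber j).card / 2 ≤ k / 2 := by
    have hcard : ∑ j, (fiber j).card = k := by
      simpa using (Finset.card_eq_sum_card_fiberwise hmaps).symm
    rw [Nat.le_div_iff_mul_le two_pos, Finset.sum_mul]
    exact (Finset.sum_le_sum fun j _ => Nat.div_mul_le_self _ _).trans hcard.le
  calc sd (mergeClusters 𝒞 f)
      ≤ ∑ j, (∑ i ∈ fiber j, kdiam (𝒞 i) + (((fiber j).card / 2 : ℕ) : ℝ) * sd 𝒞) :=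
        Finset.sum_le_sum fun j _ => kdiam_le j
    _ = sd 𝒞 + ((∑ j, (fiber j).card / 2 : ℕ) : ℝ) * sd 𝒞 := by
        rw [Finset.sum_add_distrib, ← Finset.sum_mul, Finset.sum_fiberwise_of_maps_to hmaps,
          Nat.cast_sum, sd]
    _ ≤ sd 𝒞 + ((k / 2 : ℕ) : ℝ) * sd 𝒞 := by gcongr
    _ = ((1 + k / 2 : ℕ) : ℝ) * sd 𝒞 := by push_cast; ring

/-- The uncovered holes having the `i`-th cluster on their left. -/
def uncoveredRightOf (S : Finset (ℝ × ℝ)) (𝒞 : Fin k → Finset (ℝ × ℝ)) (i : Fin k) :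
    Set (Set (ℝ × ℝ)) :=
  {h | IsHole S h ∧ ¬ Covered 𝒞 h ∧ 𝒞 i ⊆ Sleft S h}

/-- Merging the clusters that no uncovered hole separates gives a well-separated clustering
whose clusters only cover holes that were covered before. -/
theorem IsClustering.exists_wellSeparated_merge {𝒞 : Fin k → Finset (ℝ × ℝ)}
    (h𝒞 : IsClustering S k 𝒞) :
    ∃ f : Fin k → Fin k, WellSeparated S k (mergeClusters 𝒞 f) ∧
      ∀ j h, IsHole S h → h ∩ cspan (mergeClusters 𝒞 f j) ≠ ∅ → Covered 𝒞 h := by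
  let σ := uncoveredRightOf S 𝒞
  obtain ⟨f, hf⟩ : ∃ f : Fin k → Fin k, ∀ i j, f i = f j ↔ σ i = σ j := by
    refine ⟨fun i => Set.rangeSplitting σ ⟨σ i, i, rfl⟩, fun i j => ⟨fun he => ?_, fun he => ?_⟩⟩
    · simpa only [Set.apply_rangeSplitting] using congrArg σ he
    · simp only [he]
  have side : ∀ h, IsHole S h → ¬ Covered 𝒞 h → ∀ i,
      (∀ a, f a = f i → 𝒞 a ⊆ Sleft S h) ∨ (∀ a, f a = f i → 𝒞 a ⊆ Sright S h) := by
    intro h hh hunc i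
    have key : ∀ a, f a = f i → (𝒞 a ⊆ Sleft S h ↔ 𝒞 i ⊆ Sleft S h) := by
      intro a ha
      have : h ∈ σ a ↔ h ∈ σ i := by rw [(hf a i).1 ha]
      simpa [σ, uncoveredRightOf, hh, hunc] using this
    by_cases hi : 𝒞 i ⊆ Sleft S h
    · exact Or.inl fun a ha => (key a ha).2 hi
    · refine Or.inr fun a ha => ?_
      by_contra hr
      exact hunc ⟨a, hh.subset_cspan (h𝒞.subset a) (fun H => hi ((key a ha).1 H)) hr⟩
  have merge_subset : ∀ (i : Fin k) (T : Finset (ℝ × ℝ)), (∀ a, f a = f i → 𝒞 a ⊆ T) →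
      mergeClusters 𝒞 f (f i) ⊆ T := by
    intro i T hT s hs
    obtain ⟨a, ha, has⟩ := mem_mergeClusters.1 hs
    exact hT a ha has
  have hcov : ∀ j h, IsHole S h → h ∩ cspan (mergeClusters 𝒞 f j) ≠ ∅ →
      Covered 𝒞 h := by
    intro j h hh hne
    obtain ⟨p, hp, hpC⟩ := Set.nonempty_iff_ne_empty.2 hne
    by_contra hunc
    obtain ⟨-, ⟨s, hs, -⟩, -⟩ := mem_cspan_iff.1 hpC
    obtain ⟨i, rfl, -⟩ := mem_mergeClusters.1 hs
    have hnot := hh.not_subset_of_mem_cspan ((h𝒞.merge f).subset (f i)) hp hpC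
    rcases side h hh hunc i with hl | hr
    · exact hnot.1 (merge_subset i _ hl)
    · exact hnot.2 (merge_subset i _ hr)
  have separated : ∀ a b h, h ∈ σ a → h ∉ σ b →
      IsHole S h ∧ ¬ Covered (mergeClusters 𝒞 f) h ∧
        mergeClusters 𝒞 f (f a) ⊆ Sleft S h ∧
        mergeClusters 𝒞 f (f b) ⊆ Sright S h := by
    rintro a b h ⟨hh, hunc, hal⟩ hb
    have hbl : ¬ 𝒞 b ⊆ Sleft S h := fun H => hb ⟨hh, hunc, H⟩
    refine ⟨hh, fun ⟨j, hj⟩ => ?_, ?_, ?_⟩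
    · obtain ⟨p, hp⟩ := hh.nonempty
      exact hunc (hcov j h hh (Set.nonempty_iff_ne_empty.1 ⟨p, hp, hj hp⟩))
    · refine merge_subset a _ fun c hc => ?_
      have : h ∈ σ c := by rw [(hf c a).1 hc]; exact ⟨hh, hunc, hal⟩
      exact this.2.2
    · exact merge_subset b _ ((side h hh hunc b).resolve_left fun H => hbl (H b rfl))
  refine ⟨f, ⟨h𝒞.merge f, ?_⟩, hcov⟩
  rintro i j hij ⟨s, hs⟩ ⟨s', hs'⟩
  obtain ⟨a, rfl, -⟩ := mem_mergeClusters.1 hs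
  obtain ⟨b, rfl, -⟩ := mem_mergeClusters.1 hs'
  have hne : σ a ≠ σ b := fun H => hij ((hf a b).2 H)
  by_cases hsub : σ a ⊆ σ b
  · obtain ⟨h, hb, ha⟩ := Set.not_subset.1 fun H => hne (hsub.antisymm H)
    obtain ⟨hh, hunc, hl, hr⟩ := separated b a h hb ha
    exact ⟨h, hh, hunc, Or.inr ⟨hl, hr⟩⟩
  · obtain ⟨h, ha, hb⟩ := Set.not_subset.1 hsub
    obtain ⟨hh, hunc, hl, hr⟩ := separated a b h ha hb
    exact ⟨h, hh, hunc, Or.inl ⟨hl, hr⟩⟩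

end

/-- an optimal well-separated `k`-clustering is a
`(1 + ⌊k/2⌋)`-approximation for the sum of diameters. -/
theorem stmt7 (S : Finset (ℝ × ℝ)) (hS : 3 ≤ S.card) (k : ℕ)
    (hk1 : 1 ≤ k) (hkn : k ≤ S.card)
    (𝒞 : Fin k → Finset (ℝ × ℝ)) (hopt : SDOptimal S k 𝒞)
    (𝒞' : Fin k → Finset (ℝ × ℝ)) (hws : WellSeparated S k 𝒞')
    (hmin : ∀ 𝒟 : Fin k → Finset (ℝ × ℝ), WellSeparated S k 𝒟 → sd 𝒞' ≤ sd 𝒟) :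
    sd 𝒞' ≤ ((1 + k / 2 : ℕ) : ℝ) * sd 𝒞 := by
  obtain ⟨f, hf, hcov⟩ := hopt.1.exists_wellSeparated_merge
  exact (hmin _ hf).trans (sd_mergeClusters_le fun j => kdiam_le_sd hopt.1 (hcov j))
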